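/- Let ℓ > 0 be a real number with ℓ ∉ ℕ, and let δ > 0. Then there exist a continuous doubly positive function f : ℝ → ℝ with ∫_{-1}^{1} f(x) dx > 0 and a real number a such that ∫_{a-ℓ}^{a+ℓ} f(x) dx ≥ (2⌊ℓ⌋ + 1 − δ) · ∫_{-1}^{1} f(x) dx; moreover one can take a = 0. (In particular G(ℓ) ≥ 2⌊ℓ⌋+1 and C(ℓ) ≥ 2⌊ℓ⌋+1 for all non-integer ℓ.) -/

import Mathlib

open MeasureTheory Real

/-- A function `f : ℝ → ℝ` is positive definite if for every `n`, all points
`x 0, …, x (n-1)` and complex scalars `c 0, …, c (n-1)`, the real part of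
`∑ i ∑ j, c i * conj (c j) * f (x i - x j)` is nonnegative. -/
def IsPosDefFn (f : ℝ → ℝ) : Prop :=
  ∀ (n : ℕ) (x : Fin n → ℝ) (c : Fin n → ℂ),
    0 ≤ (∑ i, ∑ j, c i * (starRingEnd ℂ) (c j) * (f (x i - x j) : ℂ)).re

/-- A function is doubly positive if it is positive definite and pointwise nonnegative. -/
def IsDoublyPos (f : ℝ → ℝ) : Prop :=
  IsPosDefFn f ∧ ∀ x, 0 ≤ f x

lemma isPosDefFn_of_finite_kernel_sum {f : ℝ → ℝ} {κ : Type*} (s : Finset κ) (w : κ → ℝ)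
    (hw : ∀ k ∈ s, 0 ≤ w k) (u : κ → ℝ → ℝ)
    (hf : ∀ x y, f (x - y) = ∑ k ∈ s, w k * (u k x * u k y)) : IsPosDefFn f := by
  intro n x c
  have key : (∑ i, ∑ j, c i * (starRingEnd ℂ) (c j) * (f (x i - x j) : ℂ)) =
      ((∑ k ∈ s, w k * Complex.normSq (∑ i, c i * (u k (x i) : ℂ)) : ℝ) : ℂ) := by
    push_cast
    simp_rw [Complex.normSq_eq_conj_mul_self, map_sum, map_mul, Complex.conj_ofReal,
      Finset.sum_mul_sum, hf, Complex.ofReal_sum, Finset.mul_sum]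
    rw [Finset.sum_comm]
    simp_rw [Finset.sum_comm (s := Finset.univ) (t := s)]
    refine Finset.sum_congr rfl fun k _ => Finset.sum_congr rfl fun i _ =>
      Finset.sum_congr rfl fun j _ => ?_
    push_cast
    ring
  rw [key, Complex.ofReal_re]
  exact Finset.sum_nonneg fun k hk => mul_nonneg (hw k hk) (Complex.normSq_nonneg _)

lemma isPosDefFn_cos_pow (α : ℝ) (m : ℕ) : IsPosDefFn fun x => cos (α * x) ^ m := by
  refine isPosDefFn_of_finite_kernel_sum (Finset.range (m + 1)) (fun k => (m.choose k : ℝ))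
    (fun _ _ => Nat.cast_nonneg _)
    (fun k x => cos (α * x) ^ k * sin (α * x) ^ (m - k)) fun x y => ?_
  rw [mul_sub, cos_sub, add_pow]
  refine Finset.sum_congr rfl fun k _ => ?_
  rw [mul_pow, mul_pow]
  ring

lemma intervalIntegral_mono_interval {f : ℝ → ℝ} (hf : Continuous f) (h0 : ∀ x, 0 ≤ f x)
    {a b c d : ℝ} (hca : c ≤ a) (hab : a ≤ b) (hbd : b ≤ d) :
    ∫ x in a..b, f x ≤ ∫ x in c..d, f x :=
  intervalIntegral.integral_mono_interval hca hab hbd (Filter.Eventually.of_forall h0)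
    (hf.intervalIntegrable _ _)

/-- The integral of a nonnegative periodic function over a neighbourhood of `2 * L + 1`
consecutive multiples of its period. -/
lemma periodic_integral_lower_bound {f : ℝ → ℝ} (hf : Continuous f) (h0 : ∀ x, 0 ≤ f x)
    {s ε : ℝ} (hp : Function.Periodic f s) (hε : 0 ≤ ε) (hεs : 2 * ε ≤ s) (L : ℕ) :
    (2 * (L : ℝ) + 1) * ∫ x in -ε..ε, f x ≤ ∫ x in -(L * s + ε)..(L * s + ε), f x := by
  have hI : ∀ a b, IntervalIntegrable f volume a b := fun a b => hf.intervalIntegrable a b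
  rw [← intervalIntegral.integral_add_adjacent_intervals
    (hI (-(L * s + ε)) (-(L * s) + ε)) (hI _ _)]
  have h1 : ∫ x in -(L * s + ε)..(-(L * s) + ε), f x = ∫ x in -ε..ε, f x := by
    have h := intervalIntegral.integral_comp_sub_right (a := -ε) (b := ε) f (L * s)
    rw [show -(L * s + ε) = -ε - L * s by ring, show -(L * s) + ε = ε - L * s by ring, ← h]
    exact intervalIntegral.integral_congr fun x _ => hp.sub_nat_mul_eq L
  have h2 : ∫ x in (-(L * s) + ε)..(L * s + ε), f x = 2 * L * ∫ x in -ε..(-ε + s), f x := by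
    have h := hp.intervalIntegral_add_zsmul_eq (2 * L) (-(L * s) + ε) hI
    rw [hp.intervalIntegral_add_eq (-(L * s) + ε) (-ε)] at h
    simp only [zsmul_eq_mul] at h
    push_cast at h
    rw [← h]
    congr 1
    ring
  have h3 : ∫ x in -ε..ε, f x ≤ ∫ x in -ε..(-ε + s), f x :=
    intervalIntegral_mono_interval hf h0 le_rfl (by linarith) (by linarith)
  rw [h1, h2]
  have := mul_le_mul_of_nonneg_left h3 (show (0 : ℝ) ≤ 2 * L by positivity)
  linarith

theorem lower_bound_noninteger (ℓ : ℝ) (hℓ : 0 < ℓ) (hℓn : ∀ n : ℕ, ℓ ≠ (n : ℝ))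
    (δ : ℝ) (hδ : 0 < δ) :
    ∃ f : ℝ → ℝ, Continuous f ∧ IsDoublyPos f ∧ (0 < ∫ x in (-1 : ℝ)..1, f x) ∧
      (2 * (⌊ℓ⌋ : ℝ) + 1 - δ) * ∫ x in (-1 : ℝ)..1, f x ≤
        ∫ x in ((0 : ℝ) - ℓ)..((0 : ℝ) + ℓ), f x := by
  obtain ⟨L, hL⟩ : ∃ L : ℕ, ⌊ℓ⌋ = L := Int.eq_ofNat_of_zero_le (Int.floor_nonneg.2 hℓ.le)
  have hLℓ : (L : ℝ) < ℓ := by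
    refine lt_of_le_of_ne ?_ (hℓn L).symm
    have := Int.floor_le ℓ
    rwa [hL, Int.cast_natCast] at this
  rw [hL, Int.cast_natCast]
  obtain ⟨ε, hε, hε1, hεℓ⟩ : ∃ ε : ℝ, 0 < ε ∧ ε < 1 ∧ L * (1 + ε) + ε ≤ ℓ := by
    refine ⟨min (1 / 2) ((ℓ - L) / (L + 1)), lt_min (by norm_num)
      (div_pos (by linarith) (by positivity)), (min_le_left _ _).trans_lt (by norm_num), ?_⟩
    have h := min_le_right (1 / 2) ((ℓ - L) / (L + 1))
    rw [le_div_iff₀ (by positivity)] at h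
    linarith
  set s := 1 + ε with hs
  have hs0 : 0 < s := by positivity
  set α := π / s with hα
  have hα0 : 0 < α := by positivity
  have hαs : α * s = π := div_mul_cancel₀ _ hs0.ne'
  have hαε : α * ε < π / 2 := by
    have : α * (2 * ε) < α * s := mul_lt_mul_of_pos_left (by linarith) hα0
    linarith
  have hαε0 : 0 < α * ε := by positivity
  set p := cos (α * ε)
  set r := cos (α * (ε / 2))
  have hp0 : 0 < p := cos_pos_of_mem_Ioo ⟨by linarith, hαε⟩
  have hpr : p < r := cos_lt_cos_of_nonneg_of_le_pi (by positivity) (by linarith [pi_pos])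
    (mul_lt_mul_of_pos_left (by linarith) hα0)
  have hr0 : 0 < r := hp0.trans hpr
  obtain ⟨N, hN⟩ := exists_pow_lt_of_lt_one
    (show 0 < δ * ε / (2 * (2 * L + 1)) by positivity)
    (show (p / r) ^ 2 < 1 from pow_lt_one₀ (by positivity) ((div_lt_one hr0).2 hpr) two_ne_zero)
  rw [← pow_mul, div_pow, div_lt_div_iff₀ (by positivity) (by positivity)] at hN
  set f : ℝ → ℝ := fun x => cos (α * x) ^ (2 * N) with hf
  have hfc : Continuous f := by fun_prop
  have hf0 : ∀ x, 0 ≤ f x := fun x => (even_two_mul N).pow_nonneg _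
  have hfp : Function.Periodic f s := fun x => by
    simp only [hf, mul_add, hαs, cos_add_pi, (even_two_mul N).neg_pow]
  have hI : ∀ a b, IntervalIntegrable f volume a b := fun a b => hfc.intervalIntegrable a b
  have heven : ∀ x, f (-x) = f x := fun x => by simp only [hf, mul_neg, cos_neg]
  have htail : ∫ x in ε..1, f x ≤ p ^ (2 * N) := by
    have h : ∫ x in ε..1, f x ≤ ∫ _ in ε..1, p ^ (2 * N) := by
      refine intervalIntegral.integral_mono_on hε1.le (hI _ _) (by simp) fun x hx => ?_
      have h1 : α * ε ≤ α * x := mul_le_mul_of_nonneg_left hx.1 hα0.le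
      have h2 : α * x ≤ π - α * ε := by
        rw [← hαs, ← mul_sub]
        exact mul_le_mul_of_nonneg_left (by linarith [hx.2]) hα0.le
      change cos (α * x) ^ (2 * N) ≤ _
      rw [← (even_two_mul N).pow_abs (cos (α * x))]
      refine pow_le_pow_left₀ (abs_nonneg _) (abs_le.2 ⟨neg_le.1 ?_, ?_⟩) _
      · rw [← cos_pi_sub]
        exact cos_le_cos_of_nonneg_of_le_pi (by linarith) (by linarith) (by linarith)
      · exact cos_le_cos_of_nonneg_of_le_pi hαε0.le (by linarith) h1
    rw [intervalIntegral.integral_const, smul_eq_mul] at h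
    nlinarith [pow_pos hp0 (2 * N)]
  have htail' : ∫ x in (-1 : ℝ)..(-ε), f x = ∫ x in ε..1, f x := by
    rw [← intervalIntegral.integral_comp_neg]
    simp only [heven]
  have hcore : ε * r ^ (2 * N) ≤ ∫ x in -ε..ε, f x := by
    have h : ∫ _ in -(ε / 2)..(ε / 2), r ^ (2 * N) ≤ ∫ x in -(ε / 2)..(ε / 2), f x := by
      refine intervalIntegral.integral_mono_on (by linarith) (by simp) (hI _ _) fun x hx => ?_
      refine pow_le_pow_left₀ hr0.le ?_ _
      rw [← cos_abs (α * x), abs_mul, abs_of_pos hα0]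
      exact cos_le_cos_of_nonneg_of_le_pi (by positivity) (by linarith [pi_pos])
        (mul_le_mul_of_nonneg_left (abs_le.2 hx) hα0.le)
    rw [intervalIntegral.integral_const, smul_eq_mul] at h
    have h' := intervalIntegral_mono_interval hfc hf0 (show -ε ≤ -(ε / 2) by linarith)
      (show -(ε / 2) ≤ ε / 2 by linarith) (show ε / 2 ≤ ε by linarith)
    linarith
  have hcore0 : 0 < ∫ x in -ε..ε, f x := lt_of_lt_of_le (by positivity) hcore
  have hsplit : ∫ x in (-1 : ℝ)..1, f x = (∫ x in -ε..ε, f x) + 2 * ∫ x in ε..1, f x := by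
    rw [← intervalIntegral.integral_add_adjacent_intervals (hI (-1) (-ε)) (hI _ _),
      ← intervalIntegral.integral_add_adjacent_intervals (hI (-ε) ε) (hI _ _), htail']
    ring
  have htail0 : 0 ≤ ∫ x in ε..1, f x :=
    intervalIntegral.integral_nonneg hε1.le fun x _ => hf0 x
  refine ⟨f, hfc, ⟨isPosDefFn_cos_pow α _, hf0⟩, by linarith, ?_⟩
  have hlow := periodic_integral_lower_bound hfc hf0 hfp hε.le (by linarith) L
  have hLs : 0 ≤ L * s + ε := by positivity
  have hext := intervalIntegral_mono_interval hfc hf0 (show 0 - ℓ ≤ -(L * s + ε) by linarith)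
    (by linarith) (show L * s + ε ≤ 0 + ℓ by linarith)
  rw [hsplit]
  have h1 : (2 * (L : ℝ) + 1) * ∫ x in ε..1, f x ≤ (2 * L + 1) * p ^ (2 * N) :=
    mul_le_mul_of_nonneg_left htail (by positivity)
  have h2 := mul_le_mul_of_nonneg_left hcore hδ.le
  have h3 := mul_nonneg hδ.le htail0
  linarith
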